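/- arXiv:2505.10761 — 7 statements merged into one kernel-verified Lean document; each statement's English description precedes it below -/
import Mathlib

section
/- Let 𝒞 be a category with finite limits and let p : E ⟶ B be an exponentiable morphism in 𝒞 (i.e. the base-change functor along p has a right adjoint, the pushforward p_*). For the polynomial endofunctor P_p : 𝒞 ⥤ 𝒞 associated to p, and for any objects X and Z of 𝒞, morphisms f : Z ⟶ P_p(X) correspond bijectively to pairs consisting of a morphism f₁ : Z ⟶ B together with a morphism f₂ : Z ×_B E ⟶ X out of the pullback of p along f₁; moreover this bijection is natural in both X and Z. -/
open CategoryTheory Limits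

universe v u

/-- The polynomial endofunctor `P_p : C ⥤ C` of an exponentiable morphism `p : E ⟶ B`,
given a chosen pushforward functor `p_* : C/E ⥤ C/B` (right adjoint to base change along `p`):
it is the composite `X ↦ (X × E → E)`, followed by the pushforward, followed by the
forgetful functor `C/B ⥤ C`. -/
noncomputable def polyFunctor {C : Type u} [Category.{v} C] [HasFiniteLimits C]
    {E B : C} (_p : E ⟶ B) (pushforward : Over E ⥤ Over B) : C ⥤ C :=
  Over.star E ⋙ pushforward ⋙ Over.forget B

/-- Maps `Z ⟶ Y.left` are the same as a choice of structure map `Z ⟶ B` together with a map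
over `B`. -/
def homLeftEquivSigmaOver {C : Type u} [Category.{v} C] {B : C} (Z : C) (Y : Over B) :
    (Z ⟶ Y.left) ≃ Σ f : Z ⟶ B, (Over.mk f ⟶ Y) where
  toFun k := ⟨k ≫ Y.hom, Over.homMk k⟩
  invFun q := q.2.left
  left_inv _ := rfl
  right_inv := by
    rintro ⟨f, k⟩
    obtain ⟨l, hl, rfl⟩ : ∃ (l : Z ⟶ Y.left) (hl : l ≫ Y.hom = f), k = Over.homMk l hl :=
      ⟨k.left, Over.w k, rfl⟩
    subst hl
    rfl

/-- Base change along `p` followed by the domain functor is left adjoint to the functor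
underlying the polynomial functor of `p`. -/
noncomputable def pullbackForgetAdj {C : Type u} [Category.{v} C] [HasFiniteLimits C]
    {E B : C} {p : E ⟶ B} {pushforward : Over E ⥤ Over B}
    (adj : Over.pullback p ⊣ pushforward) :
    Over.pullback p ⋙ Over.forget E ⊣ Over.star E ⋙ pushforward :=
  adj.comp (Over.forgetAdjStar E)

/-- Maps into a value of the polynomial functor of `p`, as pairs. -/
noncomputable def polyFunctorHomEquiv {C : Type u} [Category.{v} C] [HasFiniteLimits C]
    {E B : C} {p : E ⟶ B} {pushforward : Over E ⥤ Over B}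
    (adj : Over.pullback p ⊣ pushforward) (X Z : C) :
    (Z ⟶ (polyFunctor p pushforward).obj X) ≃ Σ f₁ : Z ⟶ B, (pullback f₁ p ⟶ X) :=
  (homLeftEquivSigmaOver Z ((Over.star E ⋙ pushforward).obj X)).trans
    (Equiv.sigmaCongrRight fun f₁ => ((pullbackForgetAdj adj).homEquiv (Over.mk f₁) X).symm)

/-- The universal mapping property of the polynomial endofunctor `P_p` of an exponentiable
morphism `p : E ⟶ B` in a category with finite limits: maps `f : Z ⟶ P_p(X)` correspond
bijectively to pairs `f₁ : Z ⟶ B`, `f₂ : Z ×_B E ⟶ X`, naturally in `X` and `Z`. -/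
theorem polyFunctor_hom_equiv {C : Type u} [Category.{v} C] [HasFiniteLimits C]
    {E B : C} (p : E ⟶ B) (pushforward : Over E ⥤ Over B)
    (adj : Over.pullback p ⊣ pushforward) :
    ∃ e : ∀ (X Z : C), (Z ⟶ (polyFunctor p pushforward).obj X) ≃
        (Σ f₁ : Z ⟶ B, (pullback f₁ p ⟶ X)),
      -- naturality in `X`
      (∀ (X X' Z : C) (g : X ⟶ X') (f : Z ⟶ (polyFunctor p pushforward).obj X),
        e X' Z (f ≫ (polyFunctor p pushforward).map g) =
          ⟨(e X Z f).1, (e X Z f).2 ≫ g⟩) ∧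
      -- naturality in `Z`
      (∀ (X Z Z' : C) (h : Z' ⟶ Z) (fp : Σ f₁ : Z ⟶ B, (pullback f₁ p ⟶ X)),
        h ≫ (e X Z).symm fp = (e X Z').symm
          ⟨h ≫ fp.1,
            pullback.lift (pullback.fst (h ≫ fp.1) p ≫ h) (pullback.snd (h ≫ fp.1) p)
              (by rw [Category.assoc]; exact pullback.condition) ≫ fp.2⟩) := by
  refine ⟨polyFunctorHomEquiv adj, fun X X' Z g f => ?_, fun X Z Z' h fp => ?_⟩
  · obtain ⟨fp, rfl⟩ := (polyFunctorHomEquiv adj X Z).symm.surjective f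
    rw [Equiv.apply_symm_apply, ← Equiv.eq_symm_apply]
    exact congrArg (fun k => k.left)
      ((pullbackForgetAdj adj).homEquiv_naturality_right (X := Over.mk fp.1) fp.2 g).symm
  · let k : Over.mk (h ≫ fp.1) ⟶ Over.mk fp.1 := Over.homMk h
    exact congrArg (fun k => k.left)
      ((pullbackForgetAdj adj).homEquiv_naturality_left k fp.2).symm
end

section
/- Let 𝒞 be a locally cartesian closed category with finite limits (every slice of 𝒞 is cartesian closed, so every morphism is exponentiable). For any two morphisms p : B ⟶ A and q : D ⟶ C in 𝒞, the composite endofunctor P_p ∘ P_q (first apply P_q, then P_p) is again polynomial: there exists an exponentiable morphism r in 𝒞 together with a natural isomorphism P_r ≅ P_p ∘ P_q. -/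
open CategoryTheory Limits

universe v u

namespace CategoryTheory.Over

variable {C : Type u} [Category.{v} C] [HasFiniteLimits C]

/-- If `F ⊣ R` with `R : T ⥤ Over A`, then `R`, viewed as a functor from `Over Y` to
`Over (R.obj Y).left`, has a left adjoint. -/
def postSliceAdj {T : Type*} [Category* T] {A : C} {F : Over A ⥤ T} {R : T ⥤ Over A}
    (adj : F ⊣ R) (Y : T) :
    iteratedSliceBackward (R.obj Y) ⋙ Over.post F ⋙ Over.map (adj.counit.app Y) ⊣
      Over.post R ⋙ iteratedSliceForward (R.obj Y) :=
  (iteratedSliceEquiv (R.obj Y)).symm.toAdjunction.comp (postAdjunctionRight adj)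

/-- Pulling back `Z ⟶ N` first along `p` and then along `q` is the same as pulling it back
along the composite of the projections `D ×[X] (N ×[A] B) ⟶ N ×[A] B ⟶ N`. -/
lemma isPullback_lift_fst_comp_fst {A B X D N Z : C} (p : B ⟶ A) (q : D ⟶ X) (w : N ⟶ A)
    (e : Limits.pullback w p ⟶ X) (f : Z ⟶ N) (k : Limits.pullback (f ≫ w) p ⟶ Limits.pullback w p)
    (hk₁ : k ≫ pullback.fst w p = pullback.fst (f ≫ w) p ≫ f)
    (hk₂ : k ≫ pullback.snd w p = pullback.snd (f ≫ w) p) :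
    IsPullback (pullback.fst (k ≫ e) q ≫ pullback.fst (f ≫ w) p)
      (pullback.lift (pullback.fst (k ≫ e) q ≫ k) (pullback.snd (k ≫ e) q)
        (by simp [pullback.condition]))
      f (pullback.fst e q ≫ pullback.fst w p) := by
  have inner : IsPullback (pullback.fst (k ≫ e) q)
      (pullback.lift (pullback.fst (k ≫ e) q ≫ k) (pullback.snd (k ≫ e) q)
        (by simp [pullback.condition])) k (pullback.fst e q) := by
    refine (IsPullback.of_right ?_ (pullback.lift_fst _ _ _)
      (IsPullback.of_hasPullback e q).flip).flip
    rw [pullback.lift_snd]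
    exact (IsPullback.of_hasPullback (k ≫ e) q).flip
  have outer : IsPullback (pullback.fst (f ≫ w) p) k f (pullback.fst w p) := by
    refine (IsPullback.of_right ?_ hk₁ (IsPullback.of_hasPullback w p).flip).flip
    rw [hk₂]
    exact (IsPullback.of_hasPullback (f ≫ w) p).flip
  exact inner.paste_horiz outer

/-- The comparison isomorphisms of `isPullback_lift_fst_comp_fst` are natural in `f : Z ⟶ N`. -/
lemma isoPullback_lift_fst_comp_fst_naturality {A B X D N Z Z' : C} (p : B ⟶ A) (q : D ⟶ X)
    (w : N ⟶ A) (e : Limits.pullback w p ⟶ X) (f : Z ⟶ N) (f' : Z' ⟶ N) (h : Z ⟶ Z')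
    (hf : h ≫ f' = f)
    (k : Limits.pullback (f ≫ w) p ⟶ Limits.pullback w p)
    (hk₁ : k ≫ pullback.fst w p = pullback.fst (f ≫ w) p ≫ f)
    (hk₂ : k ≫ pullback.snd w p = pullback.snd (f ≫ w) p)
    (k' : Limits.pullback (f' ≫ w) p ⟶ Limits.pullback w p)
    (hk'₁ : k' ≫ pullback.fst w p = pullback.fst (f' ≫ w) p ≫ f')
    (hk'₂ : k' ≫ pullback.snd w p = pullback.snd (f' ≫ w) p)
    (m : Limits.pullback (f ≫ w) p ⟶ Limits.pullback (f' ≫ w) p)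
    (hm₁ : m ≫ pullback.fst _ _ = pullback.fst _ _ ≫ h)
    (hm₂ : m ≫ pullback.snd _ _ = pullback.snd _ _)
    (M : Limits.pullback (k ≫ e) q ⟶ Limits.pullback (k' ≫ e) q)
    (hM₁ : M ≫ pullback.fst _ _ = pullback.fst _ _ ≫ m)
    (hM₂ : M ≫ pullback.snd _ _ = pullback.snd _ _)
    (H : Limits.pullback f (pullback.fst e q ≫ pullback.fst w p) ⟶
      Limits.pullback f' (pullback.fst e q ≫ pullback.fst w p))
    (hH₁ : H ≫ pullback.fst _ _ = pullback.fst _ _ ≫ h)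
    (hH₂ : H ≫ pullback.snd _ _ = pullback.snd _ _) :
    M ≫ (isPullback_lift_fst_comp_fst p q w e f' k' hk'₁ hk'₂).isoPullback.hom =
      (isPullback_lift_fst_comp_fst p q w e f k hk₁ hk₂).isoPullback.hom ≫ H := by
  have hmk : m ≫ k' = k := by
    apply pullback.hom_ext
    · rw [Category.assoc, hk'₁, reassoc_of% hm₁, hf, hk₁]
    · rw [Category.assoc, hk'₂, hm₂, hk₂]
  apply pullback.hom_ext
  · simp only [Category.assoc, IsPullback.isoPullback_hom_fst, hH₁,
      IsPullback.isoPullback_hom_fst_assoc, reassoc_of% hM₁, hm₁]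
  · simp only [Category.assoc, IsPullback.isoPullback_hom_snd, hH₂]
    apply pullback.hom_ext
    · simp only [Category.assoc, pullback.lift_fst, reassoc_of% hM₁, hmk]
    · simp only [Category.assoc, pullback.lift_snd, hM₂]

/-- If `p^* ⋙ forget ⊣ R`, the left adjoint of the functor induced by `R` on slices over `X`,
followed by `q^* ⋙ forget`, is again given by base change along a single morphism. -/
noncomputable def pullbackCompForgetIso {A B X D : C} (p : B ⟶ A) (q : D ⟶ X) {R : C ⥤ Over A}
    (adj : Over.pullback p ⋙ Over.forget B ⊣ R) :
    (iteratedSliceBackward (R.obj X) ⋙ Over.post (Over.pullback p ⋙ Over.forget B) ⋙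
        Over.map (adj.counit.app X)) ⋙ Over.pullback q ⋙ Over.forget D ≅
      Over.pullback (pullback.fst (adj.counit.app X) q ≫ pullback.fst (R.obj X).hom p) ⋙
        Over.forget _ :=
  NatIso.ofComponents
    (fun f ↦ (isPullback_lift_fst_comp_fst p q (R.obj X).hom (adj.counit.app X) f.hom
      (pullback.lift (pullback.fst _ _ ≫ f.hom) (pullback.snd _ _)
        (by simp [pullback.condition])) (pullback.lift_fst _ _ _)
      (pullback.lift_snd _ _ _)).isoPullback)
    (fun {f g} k ↦ isoPullback_lift_fst_comp_fst_naturality p q (R.obj X).hom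
      (adj.counit.app X) f.hom g.hom k.left (Over.w k)
      _ (pullback.lift_fst _ _ _) (pullback.lift_snd _ _ _)
      _ (pullback.lift_fst _ _ _) (pullback.lift_snd _ _ _)
      _ (pullback.lift_fst _ _ _) (pullback.lift_snd _ _ _)
      _ (pullback.lift_fst _ _ _) (pullback.lift_snd _ _ _)
      _ (pullback.lift_fst _ _ _) (pullback.lift_snd _ _ _))

end CategoryTheory.Over

/-- In a locally cartesian closed category with finite limits (every morphism is
exponentiable, i.e. every base-change functor has a right adjoint), the composite
`P_p ∘ P_q` of the polynomial endofunctors of any two morphisms `p : B ⟶ A` and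
`q : D ⟶ C'` is again polynomial: there is an exponentiable morphism `r` with
`P_r ≅ P_p ∘ P_q`. -/
theorem polyFunctor_comp_isPolynomial {C : Type u} [Category.{v} C] [HasFiniteLimits C]
    (lcc : ∀ {X Y : C} (f : X ⟶ Y), (Over.pullback f).IsLeftAdjoint)
    {A B C' D : C} (p : B ⟶ A) (q : D ⟶ C')
    (pf_p : Over B ⥤ Over A) (adj_p : Over.pullback p ⊣ pf_p)
    (pf_q : Over D ⥤ Over C') (adj_q : Over.pullback q ⊣ pf_q) :
    ∃ (E₂ E₁ : C) (r : E₂ ⟶ E₁) (pf_r : Over E₂ ⥤ Over E₁)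
      (_ : Over.pullback r ⊣ pf_r),
      Nonempty (polyFunctor r pf_r ≅ polyFunctor q pf_q ⋙ polyFunctor p pf_p) := by
  let adj₁ := adj_p.comp (Over.forgetAdjStar B)
  let adj₂ := adj_q.comp (Over.forgetAdjStar D)
  let adj := ((Over.postSliceAdj adj₁ C').comp adj₂).ofNatIsoLeft
    (Over.pullbackCompForgetIso p q adj₁)
  let r := pullback.fst (adj₁.counit.app C') q ≫ pullback.fst ((Over.star B ⋙ pf_p).obj C').hom p
  have := lcc r
  let adj_r := Adjunction.ofIsLeftAdjoint (Over.pullback r)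
  let iso := (adj_r.comp (Over.forgetAdjStar _)).rightAdjointUniq adj
  exact ⟨_, _, r, _, adj_r, ⟨Functor.isoWhiskerRight iso (Over.forget _)⟩⟩
end

section
/- Let C be a small category and let p : Y ⟶ X be a representable morphism of presheaves on C. Then the pullback functor p^* : Ĉ/X ⥤ Ĉ/Y between slice categories has a right adjoint p_* (the pushforward), and p_* itself has a further right adjoint p^!; that is, there is an adjoint string p_! ⊣ p^* ⊣ p_* ⊣ p^!, where p_! is composition with p. In particular every representable morphism of presheaves is tiny. -/
open CategoryTheory Limits

universe u

section

open Opposite OverPresheafAux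

universe v w

namespace CategoryTheory

/-- An element of `F` over the composite `s ≫ p` is the same as an element over `s` of the pullback
of `F` along `p`. -/
noncomputable def overArrowsPullbackEquiv {C : Type w} [Category.{v} C] {X Y : Cᵒᵖ ⥤ Type v}
    (p : Y ⟶ X) (F : Over X) {c : C} (s : yoneda.obj c ⟶ Y) :
    OverArrows ((Over.pullback p).obj F).hom s ≃ OverArrows F.hom (s ≫ p) where
  toFun u := ⟨(pullback.fst F.hom p).app _ u.val, ⟨by
    have h := NatTrans.congr_app (pullback.condition (f := F.hom) (g := p)) (op c)
    have h' := ConcreteCategory.congr_hom h u.val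
    have h'' : (pullback.snd F.hom p).app _ u.val = yonedaEquiv s := u.app_val
    simp only [NatTrans.comp_app, comp_apply, h''] at h'
    rw [yonedaEquiv_comp]
    exact h'⟩⟩
  invFun u := ⟨yonedaEquiv (pullback.lift (yonedaEquiv.symm u.val) s
      (yonedaEquiv.injective (by simp [yonedaEquiv_comp, u.app_val]))),
    MakesOverArrow.of_arrow (pullback.lift_snd _ _ _)⟩
  left_inv u := by
    apply OverArrows.ext
    apply yonedaEquiv.symm.injective
    rw [OverArrows.val_mk, Equiv.symm_apply_apply]
    apply pullback.hom_ext
    · rw [pullback.lift_fst]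
      apply yonedaEquiv.injective
      simp [yonedaEquiv_comp]
    · rw [pullback.lift_snd]
      apply yonedaEquiv.injective
      simpa [yonedaEquiv_comp] using u.app_val.symm
  right_inv u := by
    apply OverArrows.ext
    rw [OverArrows.val_mk, OverArrows.val_mk]
    apply yonedaEquiv.symm.injective
    rw [← yonedaEquiv_comp, pullback.lift_fst, Equiv.symm_apply_apply]

/-- Under the equivalence between slices of a presheaf category and presheaves on categories of
elements, pullback along `p` is restriction along `CostructuredArrow.map p`. -/
noncomputable def overPullbackCompRestrictedYonedaIso {C : Type w} [Category.{v} C]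
    {X Y : Cᵒᵖ ⥤ Type v} (p : Y ⟶ X) :
    Over.pullback p ⋙ restrictedYoneda Y ≅
      restrictedYoneda X ⋙
        (Functor.whiskeringLeft _ _ (Type v)).obj (CostructuredArrow.map p).op :=
  NatIso.ofComponents
    (fun F => NatIso.ofComponents
      (fun s => (overArrowsPullbackEquiv p F s.unop.hom).toIso)
      (fun {s t} f => by
        ext u
        apply OverArrows.ext
        exact ConcreteCategory.congr_hom ((pullback.fst F.hom p).naturality f.unop.left.op) u.val))
    (fun {F G} f => by
      ext s u
      apply OverArrows.ext
      have h : ((Over.pullback p).map f).left ≫ pullback.fst G.hom p =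
          pullback.fst F.hom p ≫ f.left := pullback.lift_fst _ _ _
      exact ConcreteCategory.congr_hom (NatTrans.congr_app h (op s.unop.left)) u.val)

/-- A representable morphism induces a left adjoint functor between categories of elements. -/
lemma Functor.relativelyRepresentable.isLeftAdjoint_costructuredArrowMap {C D : Type*}
    [Category C] [Category D] {F : C ⥤ D} [F.Full] [F.Faithful] {X Y : D} {p : Y ⟶ X}
    (hp : F.relativelyRepresentable p) :
    (CostructuredArrow.map (S := F) p).IsLeftAdjoint := by
  let e (s : CostructuredArrow F Y) (t : CostructuredArrow F X) :
      ((CostructuredArrow.map p).obj s ⟶ t) ≃ (s ⟶ CostructuredArrow.mk (hp.fst t.hom)) :=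
    { toFun f := CostructuredArrow.homMk (hp.lift s.hom f.left (by simp))
        (hp.lift_fst _ _ _)
      invFun g := CostructuredArrow.homMk (g.left ≫ hp.snd t.hom) (by
        have hg : F.map g.left ≫ hp.fst t.hom = s.hom := CostructuredArrow.w g
        simp [← hp.w, reassoc_of% hg])
      left_inv f := by ext; simp
      right_inv g := by
        ext
        apply hp.hom_ext
        · simpa using (CostructuredArrow.w g).symm
        · simp }
  exact ⟨_, ⟨Adjunction.adjunctionOfEquivRight e (fun s' s t f g => by
    ext
    apply hp.hom_ext
    · simp [e]
    · simp [e])⟩⟩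

end CategoryTheory

end

/-- For a representable morphism `p : Y ⟶ X` of presheaves on a small category `C`, there
is an adjoint string `p_! ⊣ p^* ⊣ p_* ⊣ p^!`: the pullback functor `p^* : Ĉ/X ⥤ Ĉ/Y`
(whose left adjoint `p_!` is composition with `p`) has a right adjoint `p_*` (the
pushforward), which itself has a further right adjoint `p^!`.  In particular every
representable morphism of presheaves is tiny. -/
theorem representable_adjoint_string {C : Type u} [SmallCategory C]
    {X Y : Cᵒᵖ ⥤ Type u} (p : Y ⟶ X) (hp : yoneda.relativelyRepresentable p) :
    Nonempty (Over.map p ⊣ Over.pullback p) ∧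
    ∃ (pstar : Over Y ⥤ Over X) (pshriek : Over X ⥤ Over Y),
      Nonempty (Over.pullback p ⊣ pstar) ∧ Nonempty (pstar ⊣ pshriek) := by
  refine ⟨⟨Over.mapPullbackAdj p⟩, ?_⟩
  obtain ⟨R, ⟨adj⟩⟩ := hp.isLeftAdjoint_costructuredArrowMap
  let EX := overEquivPresheafCostructuredArrow X
  let EY := overEquivPresheafCostructuredArrow Y
  let L := CostructuredArrow.map (S := yoneda) p
  let e : EX.functor ⋙ (Functor.whiskeringLeft _ _ (Type u)).obj L.op ⋙ EY.inverse ≅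
      Over.pullback p :=
    Functor.isoWhiskerRight (overPullbackCompRestrictedYonedaIso p).symm EY.inverse ≪≫
      Functor.isoWhiskerLeft (Over.pullback p) EY.unitIso.symm
  exact ⟨_, _,
    ⟨(EX.toAdjunction.comp ((adj.op.whiskerLeft (Type u)).comp EY.symm.toAdjunction)).ofNatIsoLeft
      e⟩,
    ⟨(EY.toAdjunction.comp (R.op.ranAdjunction (Type u))).comp EX.symm.toAdjunction⟩⟩
end

section
/- Let C be a small category with finite limits and let p : Y ⟶ X be a morphism of presheaves on C. Then p is representable if and only if p is tiny, i.e. if and only if there exist functors p_* : Ĉ/Y ⥤ Ĉ/X and p^! : Ĉ/X ⥤ Ĉ/Y together with adjunctions p^* ⊣ p_* and p_* ⊣ p^!, where p^* : Ĉ/X ⥤ Ĉ/Y is the pullback functor along p. -/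
open CategoryTheory Limits Opposite

universe u

namespace CategoryTheory

/-- A fully faithful functor out of an idempotent complete category has an essential image that
is closed under retracts. -/
lemma Functor.exists_iso_of_retract {C D : Type*} [Category* C] [Category* D]
    [IsIdempotentComplete C] (F : C ⥤ D) [F.Full] [F.Faithful] {X : D} {c : C}
    (h : Retract X (F.obj c)) : ∃ d : C, Nonempty (F.obj d ≅ X) := by
  obtain ⟨d, i, r, hir, hri⟩ := IsIdempotentComplete.idempotents_split c
    (F.preimage (h.r ≫ h.i)) (F.map_injective (by simp))
  have hF : F.map r ≫ F.map i = h.r ≫ h.i := by rw [← F.map_comp, hri, F.map_preimage]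
  refine ⟨d, ⟨⟨F.map i ≫ h.r, h.i ≫ F.map r, ?_, ?_⟩⟩⟩
  · have : F.map i ≫ (F.map r ≫ F.map i) ≫ F.map r = 𝟙 (F.obj d) := by
      simp only [← F.map_comp, Category.assoc, hir, Category.comp_id, F.map_id]
    simpa [hF] using this
  · rw [Category.assoc, reassoc_of% hF]
    simp

/-- A presheaf `P` such that `Hom(P, -)` preserves colimits is a retract of a representable
presheaf. -/
lemma Presheaf.exists_retract_yoneda {D : Type u} [SmallCategory D] (P : Dᵒᵖ ⥤ Type u)
    [PreservesColimits (coyoneda.obj (op P))] :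
    ∃ d : D, Nonempty (Retract P (yoneda.obj d)) := by
  obtain ⟨j, f, hf⟩ := Types.jointly_surjective_of_isColimit
    (isColimitOfPreserves (coyoneda.obj (op P)) (Presheaf.isColimitTautologicalCocone P)) (𝟙 P)
  exact ⟨j.left, ⟨⟨f, j.hom, hf⟩⟩⟩

section

variable {C : Type u} [SmallCategory C] {X : Cᵒᵖ ⥤ Type u}

/-- Maps in `Over X` out of a representable presheaf over `X` are computed by evaluation under
the equivalence between `Over X` and presheaves on `CostructuredArrow yoneda X`. -/
noncomputable def coyonedaToOverIso (s : CostructuredArrow yoneda X) :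
    coyoneda.obj (op ((CostructuredArrow.toOver yoneda X).obj s)) ≅
      (overEquivPresheafCostructuredArrow X).functor ⋙ (evaluation _ _).obj (op s) :=
  (CostructuredArrow.toOverCompCoyoneda X).app (op s) ≪≫
    Functor.isoWhiskerLeft _ (curriedYonedaLemma.app (op s))

instance preservesColimits_coyoneda_toOver (s : CostructuredArrow yoneda X) :
    PreservesColimits (coyoneda.obj (op ((CostructuredArrow.toOver yoneda X).obj s))) :=
  preservesColimits_of_natIso (coyonedaToOverIso s).symm

/-- A functor to `Over X` preserves colimits as soon as its composite with `Hom(s, -)` does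
for all representable presheaves `s` over `X`. -/
lemma preservesColimits_of_comp_coyoneda_toOver {D : Type*} [Category.{u} D] (F : D ⥤ Over X)
    (hF : ∀ s : CostructuredArrow yoneda X,
      PreservesColimits (F ⋙ coyoneda.obj (op ((CostructuredArrow.toOver yoneda X).obj s)))) :
    PreservesColimits F := by
  have : PreservesColimits (F ⋙ (overEquivPresheafCostructuredArrow X).functor) :=
    preservesColimits_of_evaluation _ fun s ↦
      have := hF s.unop
      preservesColimits_of_natIso (Functor.isoWhiskerLeft F (coyonedaToOverIso s.unop))
  exact preservesColimits_of_reflects_of_preserves F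
    (overEquivPresheafCostructuredArrow X).functor

/-- A colimit preserving functor out of a slice of a presheaf category is a left adjoint. -/
lemma isLeftAdjoint_of_preservesColimits_over {E : Type*} [Category.{u} E] [HasColimits E]
    (F : Over X ⥤ E) [PreservesColimits F] : F.IsLeftAdjoint := by
  have : ((overEquivPresheafCostructuredArrow X).inverse ⋙ F).IsLeftAdjoint :=
    Presheaf.isLeftAdjoint_of_preservesColimits.{u} _
  exact (Functor.isLeftAdjoint_comp_iff_right
    (overEquivPresheafCostructuredArrow X).inverse F).1 this

/-- An object `T` of `Over X` such that `Hom(T, -)` preserves colimits is a retract of a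
representable presheaf over `X`. -/
lemma exists_retract_toOver (T : Over X) [PreservesColimits (coyoneda.obj (op T))] :
    ∃ s : CostructuredArrow yoneda X,
      Nonempty (Retract T ((CostructuredArrow.toOver yoneda X).obj s)) := by
  let e := overEquivPresheafCostructuredArrow X
  have : PreservesColimits (coyoneda.obj (op (e.functor.obj T))) :=
    preservesColimits_of_natIso (F := e.inverse ⋙ coyoneda.obj (op T))
      (e.toAdjunction.compCoyonedaIso.app (op T)).symm
  obtain ⟨s, ⟨h⟩⟩ := Presheaf.exists_retract_yoneda (e.functor.obj T)
  exact ⟨s, ⟨(Retract.ofIso (e.unitIso.app T)).trans ((h.map e.inverse).trans (Retract.ofIso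
    (e.inverse.mapIso ((CostructuredArrow.toOverCompOverEquivPresheafCostructuredArrow X).app
      s).symm ≪≫ (e.unitIso.app _).symm)))⟩⟩

variable {Y : Cᵒᵖ ⥤ Type u} (p : Y ⟶ X)

instance preservesColimits_over_pullback : PreservesColimits (Over.pullback p) :=
  preservesColimits_of_comp_coyoneda_toOver _ fun s ↦
    have : PreservesColimits
        (coyoneda.obj (op ((Over.map p).obj ((CostructuredArrow.toOver yoneda Y).obj s)))) :=
      preservesColimits_coyoneda_toOver ((CostructuredArrow.map p).obj s)
    preservesColimits_of_natIso
      ((Over.mapPullbackAdj p).compCoyonedaIso.app (op ((CostructuredArrow.toOver yoneda Y).obj s)))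

variable {p}

/-- The pullback of a representable presheaf along a representable morphism is representable. -/
lemma exists_toOver_iso_pullback (hp : yoneda.relativelyRepresentable p)
    (s : CostructuredArrow yoneda X) :
    ∃ t : CostructuredArrow yoneda Y, Nonempty ((CostructuredArrow.toOver yoneda Y).obj t ≅
      (Over.pullback p).obj ((CostructuredArrow.toOver yoneda X).obj s)) := by
  obtain ⟨b, snd, fst, h⟩ := hp s.hom
  exact ⟨CostructuredArrow.mk fst, ⟨Over.isoMk h.flip.isoPullback h.flip.isoPullback_hom_snd⟩⟩

/-- The pushforward along a representable morphism preserves colimits. -/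
lemma preservesColimits_of_relativelyRepresentable (hp : yoneda.relativelyRepresentable p)
    {G : Over Y ⥤ Over X} (adj : Over.pullback p ⊣ G) : PreservesColimits G :=
  preservesColimits_of_comp_coyoneda_toOver _ fun s ↦ by
    obtain ⟨t, ⟨e⟩⟩ := exists_toOver_iso_pullback hp s
    exact preservesColimits_of_natIso (coyoneda.mapIso e.symm.op ≪≫
      adj.compCoyonedaIso.app (op ((CostructuredArrow.toOver yoneda X).obj s)))

/-- If the pushforward along `p` preserves colimits, then `p` is representable. -/
lemma relativelyRepresentable_of_preservesColimits [IsIdempotentComplete C]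
    {G : Over Y ⥤ Over X} (adj : Over.pullback p ⊣ G) [PreservesColimits G] :
    yoneda.relativelyRepresentable p := by
  intro a g
  let s : CostructuredArrow yoneda X := CostructuredArrow.mk g
  let T := (Over.pullback p).obj ((CostructuredArrow.toOver yoneda X).obj s)
  have : PreservesColimits (coyoneda.obj (op T)) :=
    preservesColimits_of_natIso
      (F := G ⋙ coyoneda.obj (op ((CostructuredArrow.toOver yoneda X).obj s)))
      (adj.compCoyonedaIso.app (op ((CostructuredArrow.toOver yoneda X).obj s))).symm
  obtain ⟨t, ⟨h⟩⟩ := exists_retract_toOver T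
  have h' : Retract (pullback g p) (yoneda.obj t.left) := h.map (Over.forget Y)
  obtain ⟨b, ⟨e⟩⟩ := yoneda.exists_iso_of_retract h'
  refine ⟨b, yoneda.preimage (e.hom ≫ pullback.fst g p), e.hom ≫ pullback.snd g p, ?_⟩
  rw [yoneda.map_preimage]
  exact (IsPullback.of_iso (IsPullback.of_hasPullback g p) e.symm (Iso.refl _) (Iso.refl _)
    (Iso.refl _) (by simp) (by simp) (by simp) (by simp)).flip

end

end CategoryTheory

/-- Let `C` be a small category with finite limits.  A morphism `p : Y ⟶ X` of presheaves
on `C` is representable if and only if it is tiny, i.e. if and only if the pullback functor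
`p^* : Ĉ/X ⥤ Ĉ/Y` has a right adjoint `p_*` (the pushforward) which itself has a further
right adjoint `p^!`. -/
theorem representable_iff_tiny {C : Type u} [SmallCategory C] [HasFiniteLimits C]
    {X Y : Cᵒᵖ ⥤ Type u} (p : Y ⟶ X) :
    yoneda.relativelyRepresentable p ↔
      ∃ (pstar : Over Y ⥤ Over X) (pshriek : Over X ⥤ Over Y),
        Nonempty (Over.pullback p ⊣ pstar) ∧ Nonempty (pstar ⊣ pshriek) := by
  constructor
  · intro hp
    have := isLeftAdjoint_of_preservesColimits_over (Over.pullback p)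
    have adj := Adjunction.ofIsLeftAdjoint (Over.pullback p)
    have := preservesColimits_of_relativelyRepresentable hp adj
    have := isLeftAdjoint_of_preservesColimits_over (Over.pullback p).rightAdjoint
    exact ⟨_, _, ⟨adj⟩, ⟨Adjunction.ofIsLeftAdjoint _⟩⟩
  · rintro ⟨pstar, pshriek, ⟨adj⟩, ⟨adj'⟩⟩
    have : IsIdempotentComplete C :=
      (Idempotents.isIdempotentComplete_iff_hasEqualizer_of_id_and_idempotent C).2
        fun _ _ _ ↦ inferInstance
    have : PreservesColimits pstar := adj'.leftAdjoint_preservesColimits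
    exact relativelyRepresentable_of_preservesColimits adj
end

section
/- Let 𝒞 be a locally cartesian closed category with finite limits and let p : Y ⟶ X be a morphism, regarded as an object p̄ of the cartesian closed slice category 𝒞/X. Then the internal exponentiation functor (−)^p̄ : 𝒞/X ⥤ 𝒞/X has a right adjoint if and only if the pushforward functor p_* : 𝒞/Y ⥤ 𝒞/X (the right adjoint of pullback along p) has a right adjoint. -/
open CategoryTheory Limits

universe v u

namespace CategoryTheory.Over

noncomputable section

section Sections

variable {D : Type u} [Category.{v} D] [HasFiniteLimits D] {Y : D} {E : D ⥤ D}
  (adj : prod.functor.obj Y ⊣ E)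

/-- The morphism `⊤_ D ⟶ Y ^ Y` naming the identity of `Y`. -/
abbrev nameId : ⊤_ D ⟶ E.obj Y :=
  adj.homEquiv _ _ prod.fst

/-- `Y × Z` over `Y`, obtained by transposing the composite of `Z ⟶ ⊤_ D` and `nameId`. -/
def starIsoNameId :
    (equivalenceOfIsTerminal terminalIsTerminal).inverse ⋙ map (nameId adj) ⋙
      post (prod.functor.obj Y) ⋙ map (adj.counit.app Y) ≅ star Y :=
  NatIso.ofComponents
    (fun Z ↦ isoMk (Iso.refl _) (by
      have h : (prod.functor.obj Y).map (nameId adj) ≫ adj.counit.app Y = prod.fst :=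
        (adj.homEquiv_counit _ _ _).symm.trans (Equiv.symm_apply_apply _ _)
      change 𝟙 (Y ⨯ Z) ≫ prod.lift prod.fst (𝟙 (Y ⨯ Z)) ≫ prod.fst =
        (prod.functor.obj Y).map (terminal.from Z ≫ nameId adj) ≫ adj.counit.app Y
      rw [Functor.map_comp, Category.assoc, h]
      exact (Category.id_comp _).trans ((prod.lift_fst _ _).trans
        ((prod.map_fst _ _).trans (Category.comp_id _)).symm)))
    fun _ ↦ OverMorphism.ext ((Category.comp_id _).trans (Category.id_comp _).symm)

/-- The right adjoint of `Z ↦ Y × Z`, sending `A` over `Y` to the fibre of `A ^ Y ⟶ Y ^ Y` over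
the name of the identity. -/
def starSectionsAdj :
    star Y ⊣ (post E ⋙ pullback (nameId adj)) ⋙
      (equivalenceOfIsTerminal (terminalIsTerminal (C := D))).functor :=
  (((equivalenceOfIsTerminal (terminalIsTerminal (C := D))).symm.toAdjunction.comp
    ((mapPullbackAdj (nameId adj)).comp (postAdjunctionRight adj)))).ofNatIsoLeft
      (starIsoNameId adj)

theorem isLeftAdjoint_of_star_adjunction (adj : prod.functor.obj Y ⊣ E) [E.IsLeftAdjoint]
    [∀ {A B : D} (f : A ⟶ B), (pullback f).IsLeftAdjoint]
    {S : Over Y ⥤ D} (h : star Y ⊣ S) : S.IsLeftAdjoint :=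
  have := (equivalenceOfIsTerminal (terminalIsTerminal (C := D))).isLeftAdjoint_functor
  Functor.isLeftAdjoint_of_iso ((starSectionsAdj adj).rightAdjointUniq h)

end Sections

variable {C : Type u} [Category.{v} C] [HasFiniteLimits C] {X : C}

/-- Pullback in an iterated slice is computed in the base category. -/
def iteratedSlicePullbackIso {A B : Over X} (f : A ⟶ B) :
    B.iteratedSliceEquiv.functor ⋙ pullback f.left ⋙ A.iteratedSliceEquiv.inverse ≅ pullback f :=
  (((A.iteratedSliceEquiv.toAdjunction.comp
    ((mapPullbackAdj f.left).comp B.iteratedSliceEquiv.symm.toAdjunction)).ofNatIsoLeft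
      (iteratedSliceEquivOverMapIso f))).rightAdjointUniq (mapPullbackAdj f)

theorem isLeftAdjoint_pullback_over
    (lcc : ∀ {A B : C} (f : A ⟶ B), (Over.pullback f).IsLeftAdjoint)
    {A B : Over X} (f : A ⟶ B) : (pullback f).IsLeftAdjoint :=
  have := lcc f.left
  Functor.isLeftAdjoint_of_iso (iteratedSlicePullbackIso f)

/-- `star A` is, up to the equivalence `Over A ≌ Over A.left`, pullback along `A.hom`. -/
def pullbackIteratedSliceIso (A : Over X) :
    pullback A.hom ⋙ A.iteratedSliceEquiv.inverse ≅ star A :=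
  ((A.iteratedSliceEquiv.toAdjunction.comp (mapPullbackAdj A.hom)).ofNatIsoLeft
    (Functor.isoWhiskerRight A.iteratedSliceEquiv.unitIso.symm (forget A))).rightAdjointUniq
      (forgetAdjStar A)

/-- The product functor `A × -` is pullback along `A.hom` followed by composition with `A.hom`. -/
def pullbackMapIsoProd (A : Over X) :
    pullback A.hom ⋙ map A.hom ≅ prod.functor.obj A :=
  Functor.isoWhiskerRight (pullbackIteratedSliceIso A) (forget A) ≪≫
    NatIso.ofComponents (fun _ ↦ Iso.refl _) fun _ ↦
      (Category.comp_id _).trans (Category.id_comp _).symm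

end

end CategoryTheory.Over

/-- Let `C` be a locally cartesian closed category with finite limits (every base-change
functor has a right adjoint), and let `p : Y ⟶ X` be a morphism, regarded as an object
`Over.mk p` of the slice category `C/X`.  Given the internal exponentiation functor
`(−)^p : C/X ⥤ C/X` (i.e. a right adjoint `E` of the binary product functor
`Over.mk p × −`) and the pushforward functor `p_* : C/Y ⥤ C/X` (i.e. a right adjoint `pf`
of pullback along `p`), the functor `E` has a right adjoint if and only if `pf` does. -/
theorem exp_isLeftAdjoint_iff_pushforward_isLeftAdjoint
    {C : Type u} [Category.{v} C] [HasFiniteLimits C]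
    (lcc : ∀ {A B : C} (f : A ⟶ B), (Over.pullback f).IsLeftAdjoint)
    {X Y : C} (p : Y ⟶ X)
    (E : Over X ⥤ Over X) (hE : prod.functor.obj (Over.mk p) ⊣ E)
    (pf : Over Y ⥤ Over X) (hpf : Over.pullback p ⊣ pf) :
    E.IsLeftAdjoint ↔ pf.IsLeftAdjoint := by
  constructor
  · intro _
    have (A B : Over X) (f : A ⟶ B) := Over.isLeftAdjoint_pullback_over lcc f
    exact (Functor.isLeftAdjoint_comp_iff_right _ _).1 (Over.isLeftAdjoint_of_star_adjunction hE
      ((hpf.comp (Over.mk p).iteratedSliceEquiv.symm.toAdjunction).ofNatIsoLeft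
        (Over.pullbackIteratedSliceIso (Over.mk p))))
  · intro _
    have := lcc p
    exact Functor.isLeftAdjoint_of_iso
      (((hpf.comp (Over.mapPullbackAdj p)).ofNatIsoLeft
        (Over.pullbackMapIsoProd (Over.mk p))).rightAdjointUniq hE)
end

section
/- Let 𝒞 be a category with finite limits and let p : E ⟶ B be an exponentiable morphism in 𝒞. Then the polynomial endofunctor P_p : 𝒞 ⥤ 𝒞 preserves pullbacks, i.e. it preserves limits of cospan shape. -/
open CategoryTheory Limits

universe v u

/-- The polynomial endofunctor of an exponentiable morphism `p : E ⟶ B` in a category with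
finite limits preserves pullbacks, i.e. limits of cospan shape. -/
theorem polyFunctor_preserves_pullbacks {C : Type u} [Category.{v} C] [HasFiniteLimits C]
    {E B : C} (p : E ⟶ B) (pushforward : Over E ⥤ Over B)
    (adj : Over.pullback p ⊣ pushforward) :
    Nonempty (PreservesLimitsOfShape WalkingCospan (polyFunctor p pushforward)) := by
  have : PreservesLimitsOfShape WalkingCospan (Over.star E) :=
    (Over.forgetAdjStar E).rightAdjoint_preservesLimits.preservesLimitsOfShape
  have : PreservesLimitsOfShape WalkingCospan pushforward :=
    adj.rightAdjoint_preservesLimits.preservesLimitsOfShape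
  exact ⟨inferInstanceAs
    (PreservesLimitsOfShape WalkingCospan (Over.star E ⋙ pushforward ⋙ Over.forget B))⟩
end

section
/- Let 𝒞 be a category with finite limits and a subobject classifier ⊤ : 1 ⟶ Ω, and suppose ⊤ is exponentiable. Then the polynomial endofunctor P_⊤ of ⊤ is a partial map classifier: for all objects X and Z of 𝒞, morphisms Z ⟶ P_⊤(X) correspond bijectively to partial maps from Z to X, i.e. to pairs consisting of a subobject m : S ↪ Z together with a morphism f : S ⟶ X, and this bijection is natural in Z. -/
open CategoryTheory Limits

universe v u

namespace PartialMap

section Transpose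

variable {C : Type u} [Category.{v} C] [HasPullbacks C] {E B : C} {p : E ⟶ B}
  {G : C ⥤ Over B} (adj : Over.pullback p ⋙ Over.forget E ⊣ G)

/-- The morphism out of the base change of `p` along `a` corresponding to a morphism `χ`
over `a` under the adjunction. -/
noncomputable def transpose {X Z : C} (a : Z ⟶ B) (χ : Z ⟶ (G.obj X).left)
    (w : χ ≫ (G.obj X).hom = a) : pullback a p ⟶ X :=
  (adj.homEquiv (Over.mk a) X).symm (Over.homMk χ w)

theorem exists_transpose_eq {X Z : C} (a : Z ⟶ B) (t : pullback a p ⟶ X) :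
    ∃ (χ : Z ⟶ (G.obj X).left) (w : χ ≫ (G.obj X).hom = a), transpose adj a χ w = t :=
  let g : Over.mk a ⟶ G.obj X := adj.homEquiv (Over.mk a) X t
  ⟨g.left, Over.w g, (adj.homEquiv (Over.mk a) X).symm_apply_apply t⟩

theorem eq_of_transpose_eq {X Z : C} {a : Z ⟶ B} {χ χ' : Z ⟶ (G.obj X).left}
    {w : χ ≫ (G.obj X).hom = a} {w' : χ' ≫ (G.obj X).hom = a}
    (h : transpose adj a χ w = transpose adj a χ' w') : χ = χ' :=
  congrArg CommaMorphism.left ((adj.homEquiv (Over.mk a) X).symm.injective h)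

theorem comp_transpose_comp {X Z Z' S : C} (g : Z' ⟶ Z) {a : Z ⟶ B} {χ : Z ⟶ (G.obj X).left}
    (w : χ ≫ (G.obj X).hom = a) (w' : (g ≫ χ) ≫ (G.obj X).hom = g ≫ a)
    (i' : S ⟶ pullback (g ≫ a) p) (i : S ⟶ pullback a p)
    (h₁ : i' ≫ pullback.fst _ _ ≫ g = i ≫ pullback.fst _ _)
    (h₂ : i' ≫ pullback.snd _ _ = i ≫ pullback.snd _ _) :
    i' ≫ transpose adj (g ≫ a) (g ≫ χ) w' = i ≫ transpose adj a χ w := by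
  let k : Over.mk (g ≫ a) ⟶ Over.mk a := Over.homMk g rfl
  have h : transpose adj (g ≫ a) (g ≫ χ) w' =
      ((Over.pullback p).map k).left ≫ transpose adj a χ w :=
    adj.homEquiv_naturality_left_symm k (Over.homMk χ w)
  have hi : i' ≫ ((Over.pullback p).map k).left = i := by
    apply pullback.hom_ext
    · rw [Category.assoc]
      exact (congrArg (i' ≫ ·) (pullback.lift_fst _ _ _)).trans h₁
    · rw [Category.assoc]
      exact (congrArg (i' ≫ ·) (pullback.lift_snd _ _ _)).trans h₂
  rw [h, ← hi]
  exact (Category.assoc _ _ _).symm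

end Transpose

section Classifies

variable {C : Type u} [Category.{v} C] [HasFiniteLimits C] {Ω : C} {truth : ⊤_ C ⟶ Ω}
  {G : C ⥤ Over Ω} (adj : Over.pullback truth ⋙ Over.forget (⊤_ C) ⊣ G)

/-- `χ` classifies the partial map `(m, f)`: the composite `a` of `χ` with the structure morphism
to `Ω` classifies `m`, and the transpose of `χ` is `f`. -/
def Classifies {X Z S : C} (m : S ⟶ Z) (f : S ⟶ X) (χ : Z ⟶ (G.obj X).left) : Prop :=
  ∃ (a : Z ⟶ Ω) (w : χ ≫ (G.obj X).hom = a) (h : IsPullback m (terminal.from S) a truth),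
    h.isoPullback.hom ≫ transpose adj a χ w = f

variable {adj}

theorem Classifies.comp {X Z S Z' S' : C} {m : S ⟶ Z} {f : S ⟶ X} {χ : Z ⟶ (G.obj X).left}
    (h : Classifies adj m f χ) {m' : S' ⟶ Z'} {g : Z' ⟶ Z} {g' : S' ⟶ S}
    (sq : IsPullback m' g' g m) : Classifies adj m' (g' ≫ f) (g ≫ χ) := by
  obtain ⟨a, w, hp, rfl⟩ := h
  have hp' : IsPullback m' (terminal.from S') (g ≫ a) truth := by
    rw [← terminal.comp_from g']
    exact sq.paste_vert hp
  refine ⟨g ≫ a, by rw [Category.assoc, w], hp', ?_⟩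
  refine (comp_transpose_comp adj g w _ _ (g' ≫ hp.isoPullback.hom) ?_
    (Subsingleton.elim _ _)).trans (Category.assoc _ _ _)
  simp [sq.w]

theorem Classifies.unique
    (classifies : ∀ {S Z : C} (m : S ⟶ Z) [Mono m],
      ∃! χ : Z ⟶ Ω, IsPullback (terminal.from S) m truth χ)
    {X Z S : C} {m : S ⟶ Z} [Mono m] {f : S ⟶ X} {χ χ' : Z ⟶ (G.obj X).left}
    (h : Classifies adj m f χ) (h' : Classifies adj m f χ') : χ = χ' := by
  obtain ⟨a, w, hp, ht⟩ := h
  obtain ⟨a', w', hp', ht'⟩ := h'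
  obtain rfl := (classifies m).unique hp.flip hp'.flip
  exact eq_of_transpose_eq adj ((cancel_epi hp.isoPullback.hom).1 (ht.trans ht'.symm))

theorem Classifies.eq {X Z S : C} {m : S ⟶ Z} {f f' : S ⟶ X}
    {χ : Z ⟶ (G.obj X).left} (h : Classifies adj m f χ) (h' : Classifies adj m f' χ) :
    f = f' := by
  obtain ⟨_, rfl, _, rfl⟩ := h
  obtain ⟨_, rfl, _, rfl⟩ := h'
  rfl

variable (adj) in
theorem exists_classifies
    (classifies : ∀ {S Z : C} (m : S ⟶ Z) [Mono m],
      ∃! χ : Z ⟶ Ω, IsPullback (terminal.from S) m truth χ)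
    {X Z S : C} (m : S ⟶ Z) [Mono m] (f : S ⟶ X) :
    ∃ χ : Z ⟶ (G.obj X).left, Classifies adj m f χ := by
  obtain ⟨a, ha, -⟩ := classifies m
  obtain ⟨χ, w, hχ⟩ := exists_transpose_eq adj a (ha.flip.isoPullback.inv ≫ f)
  exact ⟨χ, a, w, ha.flip, by rw [hχ, Iso.hom_inv_id_assoc]⟩

variable (adj) in
theorem classifies_of_isPullback {X Z S : C} {m : S ⟶ Z} {χ : Z ⟶ (G.obj X).left}
    (h : IsPullback m (terminal.from S) (χ ≫ (G.obj X).hom) truth) :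
    Classifies adj m (h.isoPullback.hom ≫ transpose adj _ χ rfl) χ :=
  ⟨_, rfl, h, rfl⟩

theorem Classifies.precomp_iso {X Z S S' : C} {m : S ⟶ Z} {f : S ⟶ X} {χ : Z ⟶ (G.obj X).left}
    (h : Classifies adj m f χ) (i : S' ≅ S) : Classifies adj (i.hom ≫ m) (i.hom ≫ f) χ := by
  have := h.comp (g := 𝟙 Z) (IsPullback.of_vert_isIso ⟨by simp⟩ :
    IsPullback (i.hom ≫ m) i.hom (𝟙 Z) m)
  rwa [Category.id_comp] at this

theorem Classifies.isPullback
    (classifies : ∀ {S Z : C} (m : S ⟶ Z) [Mono m],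
      ∃! χ : Z ⟶ Ω, IsPullback (terminal.from S) m truth χ)
    {X Z S : C} {m : S ⟶ Z} [Mono m] {f : S ⟶ X} {χ : Z ⟶ (G.obj X).left}
    {η : X ⟶ (G.obj X).left} (hη : Classifies adj (𝟙 X) (𝟙 X) η) (h : Classifies adj m f χ) :
    IsPullback f m η χ := by
  have total {W : C} (a : W ⟶ X) : Classifies adj (𝟙 W) a (a ≫ η) := by
    simpa using hη.comp (IsPullback.of_horiz_isIso ⟨by simp⟩ : IsPullback (𝟙 W) a a (𝟙 X))
  have w : f ≫ η = m ≫ χ := by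
    refine (total f).unique classifies ?_
    simpa using h.comp (IsKernelPair.id_of_mono m)
  have : Mono η := ⟨fun a b hab ↦ (total a).eq (hab ▸ total b)⟩
  obtain ⟨a, ha, hp, -⟩ := h
  have factors (s : PullbackCone η χ) : s.snd ≫ a = terminal.from _ ≫ truth := by
    obtain ⟨_, rfl, hs, -⟩ := total s.fst
    rw [← hs.w, Category.id_comp, s.condition, Category.assoc, ha]
  refine ⟨⟨w⟩, ⟨PullbackCone.IsLimit.mk _
    (fun s ↦ hp.lift s.snd (terminal.from _) (factors s)) (fun s ↦ ?_) (fun s ↦ by simp) ?_⟩⟩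
  · rw [← cancel_mono η, Category.assoc, w, IsPullback.lift_fst_assoc, s.condition]
  · intro s k _ hk
    rw [← cancel_mono m, hk, IsPullback.lift_fst]

variable (adj) in
/-- Subobjects of `Z` equipped with a morphism to `X` correspond to the morphisms classifying
them. -/
theorem exists_equiv_classifies
    (classifies : ∀ {S Z : C} (m : S ⟶ Z) [Mono m],
      ∃! χ : Z ⟶ Ω, IsPullback (terminal.from S) m truth χ) (X Z : C) :
    ∃ e : (Z ⟶ (G.obj X).left) ≃ (Σ S : Subobject Z, ((S : C) ⟶ X)),
      ∀ s, Classifies adj s.1.arrow s.2 (e.symm s) := by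
  choose c hc using fun s : Σ S : Subobject Z, ((S : C) ⟶ X) ↦
    exists_classifies adj classifies s.1.arrow s.2
  refine ⟨(Equiv.ofBijective c ⟨?_, fun χ ↦ ?_⟩).symm, hc⟩
  · rintro ⟨S, f⟩ ⟨S', f'⟩ h
    have h₁ := hc ⟨S, f⟩
    have h₂ := hc ⟨S', f'⟩
    rw [← h] at h₂
    obtain rfl : S = S' := by
      obtain ⟨_, rfl, hp, -⟩ := h₁
      obtain ⟨_, rfl, hp', -⟩ := h₂
      exact Subobject.eq_of_comm (hp.isoIsPullback _ _ hp') (by simp)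
    obtain rfl := h₁.eq h₂
    rfl
  · have hp : IsPullback (Subobject.mk (pullback.fst (χ ≫ (G.obj X).hom) truth)).arrow
        (terminal.from _) (χ ≫ (G.obj X).hom) truth :=
      .of_iso (.of_hasPullback (χ ≫ (G.obj X).hom) truth)
        (Subobject.underlyingIso _).symm (.refl _) (.refl _) (.refl _)
        (by simp) (Subsingleton.elim _ _) (by simp) (by simp)
    exact ⟨⟨_, _⟩, (hc _).unique classifies (classifies_of_isPullback adj hp)⟩

end Classifies

end PartialMap

/-- Let `C` be a category with finite limits and a subobject classifier `⊤ : 1 ⟶ Ω`, and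
suppose `⊤` is exponentiable (with pushforward `pf`).  Then the polynomial endofunctor
`P_⊤` is a partial map classifier: for all objects `X` and `Z`, morphisms `Z ⟶ P_⊤(X)`
correspond bijectively to partial maps from `Z` to `X`, i.e. to pairs of a subobject
`S ↪ Z` and a morphism `(S : C) ⟶ X`; naturality of this bijection in `Z` is expressed by
the fact that every `χ : Z ⟶ P_⊤(X)` fits into a pullback square against the universal
partial map `η : X ⟶ P_⊤(X)` (the one classifying the identity partial map on `X`). -/
theorem polyFunctor_partial_map_classifier {C : Type u} [Category.{v} C] [HasFiniteLimits C]
    {Ω : C} (truth : ⊤_ C ⟶ Ω) [Mono truth]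
    (classifies : ∀ {S Z : C} (m : S ⟶ Z) [Mono m],
      ∃! χ : Z ⟶ Ω, IsPullback (terminal.from S) m truth χ)
    (pf : Over (⊤_ C) ⥤ Over Ω) (adj : Over.pullback truth ⊣ pf) :
    ∃ e : ∀ (X Z : C),
        (Z ⟶ (polyFunctor truth pf).obj X) ≃ (Σ S : Subobject Z, ((S : C) ⟶ X)),
      ∀ (X Z : C) (χ : Z ⟶ (polyFunctor truth pf).obj X),
        IsPullback (e X Z χ).2 (e X Z χ).1.arrow
          ((e X X).symm ⟨Subobject.mk (𝟙 X), (Subobject.mk (𝟙 X)).arrow⟩) χ := by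
  choose e he using
    PartialMap.exists_equiv_classifies (adj.comp (Over.forgetAdjStar (⊤_ C))) classifies
  refine ⟨e, fun X Z χ ↦ ?_⟩
  have hη := (he X X ⟨Subobject.mk (𝟙 X), (Subobject.mk (𝟙 X)).arrow⟩).precomp_iso
    (Subobject.underlyingIso (𝟙 X)).symm
  have hχ := he X Z (e X Z χ)
  rw [(e X Z).symm_apply_apply χ] at hχ
  simp only [Iso.symm_hom, Subobject.underlyingIso_arrow] at hη
  exact hη.isPullback classifies hχ
end
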